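/- arXiv:2503.18700 — 2 statements merged into one kernel-verified Lean document; each statement's English description precedes it below -/
import Mathlib

section
/- (Discrete splitting lemma) Let G be a finite connected subgraph of the infinite grid graph on ℤ², let u be an integer vector, and let a, b be positive integers with a + b = n. If G realises the vector n·u (some two vertices of G differ by n·u), then G realises a·u or G realises b·u. -/
def gridAdj (a b : ℤ × ℤ) : Prop := |a.1 - b.1| + |a.2 - b.2| = 1

/-- A finite vertex set `S` realises the vector `v` if two of its vertices differ by `v`. -/
def realises (S : Finset (ℤ × ℤ)) (v : ℤ × ℤ) : Prop := ∃ a ∈ S, ∃ b ∈ S, a - b = v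

/-- `S` is the vertex set of a connected subgraph of the infinite grid graph on `ℤ²`:
any two vertices are joined by a path of grid steps staying inside `S`. -/
def connectedIn (S : Finset (ℤ × ℤ)) : Prop :=
  ∀ a ∈ S, ∀ b ∈ S, Relation.ReflTransGen (fun x y => x ∈ S ∧ y ∈ S ∧ gridAdj x y) a b

/-- The complex number attached to a lattice point. -/
noncomputable def toC (x : ℤ × ℤ) : ℂ := ⟨(x.1 : ℝ), (x.2 : ℝ)⟩

/-- Signed angle from `x` to `y`. -/
noncomputable def ang (x y : ℤ × ℤ) : ℝ := Complex.arg (toC y / toC x)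

theorem toC_ne {x : ℤ × ℤ} (h : x ≠ 0) : toC x ≠ 0 := by
  intro h0
  apply h
  have h1 := congrArg Complex.re h0
  have h2 := congrArg Complex.im h0
  simp [toC] at h1 h2
  exact Prod.ext h1 h2

theorem adj_cases {x y : ℤ × ℤ} (h : gridAdj x y) :
    (y.1 = x.1 + 1 ∧ y.2 = x.2) ∨ (y.1 = x.1 - 1 ∧ y.2 = x.2) ∨
    (y.1 = x.1 ∧ y.2 = x.2 + 1) ∨ (y.1 = x.1 ∧ y.2 = x.2 - 1) := by
  unfold gridAdj at h
  rcases abs_cases (x.1 - y.1) with h1 | h1 <;> rcases abs_cases (x.2 - y.2) with h2 | h2 <;> omega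

theorem adj_dot {x y : ℤ × ℤ} (h : gridAdj x y) : 0 ≤ x.1 * y.1 + x.2 * y.2 := by
  have key : ∀ t : ℤ, 0 ≤ t * (t + 1) := by
    intro t
    rcases le_or_gt 0 t with h | h
    · positivity
    · nlinarith
  rcases adj_cases h with ⟨h1, h2⟩ | ⟨h1, h2⟩ | ⟨h1, h2⟩ | ⟨h1, h2⟩ <;> rw [h1, h2]
  · nlinarith [key x.1, sq_nonneg x.2]
  · nlinarith [key (x.1 - 1), sq_nonneg x.2]
  · nlinarith [key x.2, sq_nonneg x.1]
  · nlinarith [key (x.2 - 1), sq_nonneg x.1]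

/-- In a closed half plane the signed angle along an edge is a difference of arguments. -/
theorem ang_eq {x y : ℤ × ℤ} (h : gridAdj x y) (hx : x ≠ 0) (hy : y ≠ 0) {c : ℂ} (hc : c ≠ 0)
    (h1 : 0 ≤ (toC x * c).re) (h2 : 0 ≤ (toC y * c).re) :
    ang x y = Complex.arg (toC y * c) - Complex.arg (toC x * c) := by
  have hx' := mul_ne_zero (toC_ne hx) hc
  have hy' := mul_ne_zero (toC_ne hy) hc
  have e : toC y / toC x = (toC y * c) / (toC x * c) := by
    rw [mul_div_mul_right _ _ hc]
  have a1 := abs_le.1 (Complex.abs_arg_le_pi_div_two_iff.2 h1)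
  have a2 := abs_le.1 (Complex.abs_arg_le_pi_div_two_iff.2 h2)
  have hang := Complex.arg_div_coe_angle hy' hx'
  rw [← Real.Angle.coe_sub] at hang
  have ht := congrArg Real.Angle.toReal hang
  rw [Complex.arg_coe_angle_toReal_eq_arg, Real.Angle.toReal_coe_eq_self_iff.2] at ht
  · unfold ang
    rw [e, ht]
  · constructor
    · by_contra hcon
      have b1 : Complex.arg (toC y * c) = -(Real.pi / 2) := by linarith
      have b2 : Complex.arg (toC x * c) = Real.pi / 2 := by linarith
      rw [Complex.arg_eq_neg_pi_div_two_iff] at b1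
      rw [Complex.arg_eq_pi_div_two_iff] at b2
      have hd : (0 : ℝ) ≤ x.1 * y.1 + x.2 * y.2 := by exact_mod_cast adj_dot h
      have hid : (toC x * c).re * (toC y * c).re + (toC x * c).im * (toC y * c).im
          = (c.re ^ 2 + c.im ^ 2) * (x.1 * y.1 + x.2 * y.2) := by
        simp only [toC, Complex.mul_re, Complex.mul_im]; ring
      rw [b1.1, b2.1] at hid
      have : 0 ≤ (c.re ^ 2 + c.im ^ 2) * ((x.1 : ℝ) * y.1 + x.2 * y.2) := by positivity
      nlinarith [mul_neg_of_pos_of_neg b2.2 b1.2]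
    · linarith

/-- The angle form is closed on elementary squares. -/
theorem ang_square {w x y z : ℤ × ℤ} {e f : ℤ × ℤ} (he : gridAdj 0 e) (hf : gridAdj 0 f)
    (hx : x = w + e) (hy : y = w + f) (hz : z = w + e + f)
    (w0 : w ≠ 0) (x0 : x ≠ 0) (y0 : y ≠ 0) (z0 : z ≠ 0) :
    ang w x + ang x z = ang w y + ang y z := by
  have tr : ∀ p q d : ℤ × ℤ, gridAdj 0 d → q = p + d → gridAdj p q := by
    intro p q d hd h
    subst h
    simpa [gridAdj] using hd
  have awx := tr w x e he hx
  have awy := tr w y f hf hy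
  have axz := tr x z f hf (by rw [hz, hx])
  have ayz := tr y z e he (by rw [hz, hy]; abel)
  have main : ∀ c : ℂ, c ≠ 0 → 0 ≤ (toC w * c).re → 0 ≤ (toC x * c).re → 0 ≤ (toC y * c).re →
      0 ≤ (toC z * c).re → ang w x + ang x z = ang w y + ang y z := by
    intro c hc h1 h2 h3 h4
    rw [ang_eq awx w0 x0 hc h1 h2, ang_eq axz x0 z0 hc h2 h4, ang_eq awy w0 y0 hc h1 h3,
      ang_eq ayz y0 z0 hc h3 h4]
    ring
  have cs : (0 ≤ w.1 ∧ 0 ≤ x.1 ∧ 0 ≤ y.1 ∧ 0 ≤ z.1) ∨ (w.1 ≤ 0 ∧ x.1 ≤ 0 ∧ y.1 ≤ 0 ∧ z.1 ≤ 0) ∨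
      (0 ≤ w.2 ∧ 0 ≤ x.2 ∧ 0 ≤ y.2 ∧ 0 ≤ z.2) ∨ (w.2 ≤ 0 ∧ x.2 ≤ 0 ∧ y.2 ≤ 0 ∧ z.2 ≤ 0) := by
    have c1 := adj_cases he
    have c2 := adj_cases hf
    obtain ⟨w1, w2⟩ := w
    obtain ⟨e1, e2⟩ := e
    obtain ⟨f1, f2⟩ := f
    subst hx hy hz
    simp only [ne_eq, Prod.mk_add_mk, Prod.mk_eq_zero, Prod.fst_zero, Prod.snd_zero] at w0 x0 y0 z0 c1 c2 ⊢
    clear main awx awy axz ayz tr he hf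
    rcases c1 with ⟨h1, h2⟩ | ⟨h1, h2⟩ | ⟨h1, h2⟩ | ⟨h1, h2⟩ <;>
      rcases c2 with ⟨h3, h4⟩ | ⟨h3, h4⟩ | ⟨h3, h4⟩ | ⟨h3, h4⟩ <;>
      subst h1 h2 h3 h4 <;> omega
  rcases cs with h | h | h | h
  · obtain ⟨h1, h2, h3, h4⟩ := h
    apply main 1 one_ne_zero <;> simp [toC] <;> assumption
  · obtain ⟨h1, h2, h3, h4⟩ := h
    apply main (-1) (by simp) <;> simp [toC] <;> assumption
  · obtain ⟨h1, h2, h3, h4⟩ := h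
    apply main (-Complex.I) (by simp) <;> simp [toC] <;> assumption
  · obtain ⟨h1, h2, h3, h4⟩ := h
    apply main Complex.I (by simp) <;> simp [toC] <;> assumption

/-- Telescoping of the angle sum along a path in a closed half plane. -/
theorem ang_sum {c : ℂ} (hc : c ≠ 0) (g : ℕ → ℤ × ℤ) (N : ℕ)
    (h0 : ∀ i ≤ N, g i ≠ 0) (hre : ∀ i ≤ N, 0 ≤ (toC (g i) * c).re)
    (hadj : ∀ i < N, gridAdj (g i) (g (i + 1))) :
    ∑ i ∈ Finset.range N, ang (g i) (g (i + 1)) =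
      Complex.arg (toC (g N) * c) - Complex.arg (toC (g 0) * c) := by
  rw [← Finset.sum_range_sub (fun i => Complex.arg (toC (g i) * c))]
  apply Finset.sum_congr rfl
  intro i hi
  have hi := Finset.mem_range.1 hi
  exact ang_eq (hadj i hi) (h0 i hi.le) (h0 (i + 1) hi) hc (hre i hi.le) (hre (i + 1) hi)

theorem ang_rect (p q : ℕ → ℤ × ℤ) (N M : ℕ)
    (hp : ∀ i < N, gridAdj (p i) (p (i + 1))) (hq : ∀ i < M, gridAdj (q i) (q (i + 1)))
    (hne : ∀ i ≤ N, ∀ j ≤ M, p i - q j ≠ 0) (j : ℕ) (hj : j ≤ M) :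
    ∑ i ∈ Finset.range N, ang (p i - q 0) (p (i + 1) - q 0) +
      ∑ k ∈ Finset.range j, ang (p N - q k) (p N - q (k + 1)) =
    ∑ k ∈ Finset.range j, ang (p 0 - q k) (p 0 - q (k + 1)) +
      ∑ i ∈ Finset.range N, ang (p i - q j) (p (i + 1) - q j) := by
  induction j with
  | zero => simp
  | succ j ih =>
    have ih := ih (by omega)
    rw [Finset.sum_range_succ, Finset.sum_range_succ]
    have step : ∀ n ≤ N, ∑ i ∈ Finset.range n, ang (p i - q j) (p (i + 1) - q j) +
        ang (p n - q j) (p n - q (j + 1)) = ang (p 0 - q j) (p 0 - q (j + 1)) +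
        ∑ i ∈ Finset.range n, ang (p i - q (j + 1)) (p (i + 1) - q (j + 1)) := by
      intro n hn
      induction n with
      | zero => simp
      | succ n ihn =>
        have ihn := ihn (by omega)
        rw [Finset.sum_range_succ, Finset.sum_range_succ]
        have := ang_square (w := p n - q j) (x := p (n + 1) - q j) (y := p n - q (j + 1))
          (z := p (n + 1) - q (j + 1)) (e := p (n + 1) - p n) (f := q j - q (j + 1))
          (by have := hp n (by omega)
              simp only [gridAdj, Prod.fst_zero, Prod.snd_zero, Prod.fst_sub, Prod.snd_sub,
                zero_sub, neg_sub] at this ⊢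
              exact this)
          (by have := hq j (by omega)
              simp only [gridAdj, Prod.fst_zero, Prod.snd_zero, Prod.fst_sub, Prod.snd_sub,
                zero_sub, neg_sub] at this ⊢
              rw [abs_sub_comm, abs_sub_comm (q (j + 1)).2]
              exact this)
          (by abel) (by abel) (by abel)
          (hne n (by omega) j (by omega)) (hne (n + 1) (by omega) j (by omega))
          (hne n (by omega) (j + 1) (by omega)) (hne (n + 1) (by omega) (j + 1) (by omega))
        linarith
    have := step N le_rfl
    linarith

/-- Linear functional vanishing on `u`. -/
def ell (u x : ℤ × ℤ) : ℤ := u.1 * x.2 - u.2 * x.1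

theorem ell_sub (u x y : ℤ × ℤ) : ell u (x - y) = ell u x - ell u y := by
  simp only [ell, Prod.fst_sub, Prod.snd_sub]; ring

theorem ell_add_smul (u x : ℤ × ℤ) (k : ℤ) : ell u (x + k • u) = ell u x := by
  simp only [ell, Prod.fst_add, Prod.snd_add, Prod.smul_fst, Prod.smul_snd, smul_eq_mul]; ring

/-- Crossing lemma in a strip. -/
theorem crossing (u : ℤ × ℤ) (hu : u ≠ 0) (p q : ℕ → ℤ × ℤ) (N M : ℕ) (a b : ℤ)
    (ha : 0 < a) (hb : 0 < b)
    (hp : ∀ i < N, gridAdj (p i) (p (i + 1))) (hq : ∀ i < M, gridAdj (q i) (q (i + 1)))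
    (hne : ∀ i ≤ N, ∀ j ≤ M, p i - q j ≠ 0)
    (h1 : ∀ i ≤ N, ell u (p i - q 0) ≤ 0) (h2 : ∀ j ≤ M, ell u (p N - q j) ≤ 0)
    (h3 : ∀ j ≤ M, 0 ≤ ell u (p 0 - q j)) (h4 : ∀ i ≤ N, 0 ≤ ell u (p i - q M))
    (hA : p 0 - q 0 = (-a) • u) (hB : p N - q M = b • u) : False := by
  have hR := ang_rect p q N M hp hq hne M le_rfl
  have adp : ∀ v, ∀ i < N, gridAdj (p i - v) (p (i + 1) - v) := by
    intro v i hi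
    have := hp i hi
    simpa [gridAdj] using this
  have adq : ∀ v, ∀ i < M, gridAdj (v - q i) (v - q (i + 1)) := by
    intro v i hi
    have := hq i hi
    simp only [gridAdj, Prod.fst_sub, Prod.snd_sub, sub_sub_sub_cancel_left] at this ⊢
    rw [abs_sub_comm, abs_sub_comm (q (i + 1)).2]
    exact this
  set c : ℂ := ⟨(u.2 : ℝ), (u.1 : ℝ)⟩ with hcdef
  have hc : c ≠ 0 := by
    intro h0
    apply hu
    have h1 := congrArg Complex.re h0
    have h2 := congrArg Complex.im h0
    simp [hcdef] at h1 h2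
    exact Prod.ext h2 h1
  have re1 : ∀ x, (toC x * c).re = -(ell u x : ℝ) := by
    intro x; simp [toC, hcdef, ell]; ring
  have re2 : ∀ x, (toC x * (-c)).re = (ell u x : ℝ) := by
    intro x; simp [toC, hcdef, ell]; ring
  have lo : ∀ x, ell u x ≤ 0 → 0 ≤ (toC x * c).re := by
    intro x h; rw [re1]; have : (ell u x : ℝ) ≤ 0 := by exact_mod_cast h
    linarith
  have up : ∀ x, 0 ≤ ell u x → 0 ≤ (toC x * (-c)).re := by
    intro x h; rw [re2]; exact_mod_cast h
  rw [ang_sum hc (fun i => p i - q 0) N (fun i hi => hne i hi 0 (by omega))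
      (fun i hi => lo _ (h1 i hi)) (adp _),
    ang_sum hc (fun j => p N - q j) M (fun j hj => hne N le_rfl j hj)
      (fun j hj => lo _ (h2 j hj)) (adq _),
    ang_sum (neg_ne_zero.2 hc) (fun j => p 0 - q j) M (fun j hj => hne 0 (by omega) j hj)
      (fun j hj => up _ (h3 j hj)) (adq _),
    ang_sum (neg_ne_zero.2 hc) (fun i => p i - q M) N (fun i hi => hne i hi M le_rfl)
      (fun i hi => up _ (h4 i hi)) (adp _)] at hR
  simp only [hA, hB] at hR
  have hpos : (0 : ℝ) < (u.1 : ℝ) ^ 2 + (u.2 : ℝ) ^ 2 := by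
    have : u.1 ≠ 0 ∨ u.2 ≠ 0 := by
      by_contra hcon
      push Not at hcon
      exact hu (Prod.ext hcon.1 hcon.2)
    rcases this with h | h
    · have : (u.1 : ℝ) ≠ 0 := by exact_mod_cast h
      positivity
    · have : (u.2 : ℝ) ≠ 0 := by exact_mod_cast h
      positivity
  have im1 : ∀ k : ℤ, (toC (k • u) * c).re = 0 ∧
      (toC (k • u) * c).im = k * ((u.1 : ℝ) ^ 2 + (u.2 : ℝ) ^ 2) := by
    intro k; constructor <;> simp [toC, hcdef] <;> ring
  have pa : (0 : ℝ) < a := by exact_mod_cast ha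
  have pb : (0 : ℝ) < b := by exact_mod_cast hb
  have mA := mul_pos pa hpos
  have mB := mul_pos pb hpos
  have v1 : Complex.arg (toC (b • u) * c) = Real.pi / 2 := by
    rw [Complex.arg_eq_pi_div_two_iff, (im1 b).1, (im1 b).2]; exact ⟨rfl, mB⟩
  have v2 : Complex.arg (toC ((-a) • u) * c) = -(Real.pi / 2) := by
    rw [Complex.arg_eq_neg_pi_div_two_iff, (im1 (-a)).1, (im1 (-a)).2]
    refine ⟨rfl, ?_⟩
    push_cast; linarith
  have v3 : Complex.arg (toC (b • u) * (-c)) = -(Real.pi / 2) := by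
    rw [Complex.arg_eq_neg_pi_div_two_iff, mul_neg, Complex.neg_re, Complex.neg_im,
      (im1 b).1, (im1 b).2]
    exact ⟨neg_zero, by linarith⟩
  have v4 : Complex.arg (toC ((-a) • u) * (-c)) = Real.pi / 2 := by
    rw [Complex.arg_eq_pi_div_two_iff, mul_neg, Complex.neg_re, Complex.neg_im,
      (im1 (-a)).1, (im1 (-a)).2]
    refine ⟨neg_zero, ?_⟩
    push_cast; linarith
  rw [v1, v2, v3, v4] at hR
  linarith [Real.pi_pos]

theorem path_of_rel (R : Set (ℤ × ℤ)) (x y : ℤ × ℤ) (hx : x ∈ R)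
    (h : Relation.ReflTransGen (fun x y => x ∈ R ∧ y ∈ R ∧ gridAdj x y) x y) :
    ∃ (N : ℕ) (p : ℕ → ℤ × ℤ), p 0 = x ∧ p N = y ∧ (∀ i ≤ N, p i ∈ R) ∧
      ∀ i < N, gridAdj (p i) (p (i + 1)) := by
  induction h with
  | refl => exact ⟨0, fun _ => x, rfl, rfl, fun _ _ => hx, by simp⟩
  | @tail y z _ hyz ih =>
    obtain ⟨N, p, h0, hN, hm, ha⟩ := ih
    refine ⟨N + 1, fun i => if i ≤ N then p i else z, by simp [h0], by simp, ?_, ?_⟩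
    · intro i _
      by_cases h : i ≤ N
      · simpa [h] using hm i h
      · simpa [h] using hyz.2.1
    · intro i hi
      by_cases h : i + 1 ≤ N
      · have h' : i ≤ N := by omega
        simpa [h, h'] using ha i (by omega)
      · have h' : i = N := by omega
        subst h'
        simpa [hN] using hyz.2.2

/-- Discrete splitting lemma: if a finite connected subgraph of the grid realises
`(a + b) • u` with `a, b` positive, then it realises `a • u` or `b • u`. -/
theorem discrete_splitting (S : Finset (ℤ × ℤ)) (hconn : connectedIn S) (u : ℤ × ℤ)
    (a b n : ℕ) (ha : 0 < a) (hb : 0 < b) (hab : a + b = n)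
    (h : realises S ((n : ℤ) • u)) :
    realises S ((a : ℤ) • u) ∨ realises S ((b : ℤ) • u) := by
  obtain ⟨x, hx, y, hy, hxy⟩ := h
  by_cases hu : u = 0
  · left
    exact ⟨x, hx, x, hx, by simp [hu]⟩
  by_contra hcon
  push Not at hcon
  obtain ⟨hna, hnb⟩ := hcon
  obtain ⟨m, hm, hmax⟩ := S.exists_max_image (ell u) ⟨x, hx⟩
  obtain ⟨m', hm', hmin⟩ := S.exists_min_image (ell u) ⟨x, hx⟩
  have hn : (n : ℤ) = a + b := by omega
  -- the translated relation
  have shift : ∀ (R : Set (ℤ × ℤ)) (v : ℤ × ℤ), (∀ s ∈ S, s + v ∈ R) → ∀ s ∈ S, ∀ t ∈ S,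
      Relation.ReflTransGen (fun x y => x ∈ R ∧ y ∈ R ∧ gridAdj x y) (s + v) (t + v) := by
    intro R v hR s hs t ht
    refine Relation.ReflTransGen.lift (fun z => z + v) ?_ _ _ (hconn s hs t ht)
    rintro z w ⟨hz, hw, hzw⟩
    refine ⟨hR z hz, hR w hw, ?_⟩
    simpa [gridAdj] using hzw
  let R : Set (ℤ × ℤ) := {z | z ∈ S ∨ ∃ s ∈ S, z = s + (n : ℤ) • u}
  let T : Set (ℤ × ℤ) := {z | ∃ s ∈ S, z = s + (a : ℤ) • u}
  have r1 := shift R 0 (fun s hs => Or.inl (by simpa using hs)) m hm x hx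
  have r2 := shift R ((n : ℤ) • u) (fun s hs => Or.inr ⟨s, hs, rfl⟩) y hy m' hm'
  have exy : y + (n : ℤ) • u = x := by rw [← hxy]; abel
  rw [exy] at r2
  simp only [add_zero] at r1
  obtain ⟨N, p, p0, pN, pR, padj⟩ := path_of_rel R _ _ (Or.inl hm) (r1.trans r2)
  obtain ⟨M, q, q0, qM, qT, qadj⟩ := path_of_rel T _ _ ⟨m, hm, rfl⟩
    (shift T ((a : ℤ) • u) (fun s hs => ⟨s, hs, rfl⟩) m hm m' hm')
  have bR : ∀ z ∈ R, ell u z ≤ ell u m ∧ ell u m' ≤ ell u z := by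
    rintro z (hz | ⟨s, hs, rfl⟩)
    · exact ⟨hmax z hz, hmin z hz⟩
    · rw [ell_add_smul]; exact ⟨hmax s hs, hmin s hs⟩
  have bT : ∀ z ∈ T, ell u z ≤ ell u m ∧ ell u m' ≤ ell u z := by
    rintro z ⟨s, hs, rfl⟩
    rw [ell_add_smul]; exact ⟨hmax s hs, hmin s hs⟩
  refine crossing u hu p q N M a b (by exact_mod_cast ha) (by exact_mod_cast hb) padj qadj
    ?_ ?_ ?_ ?_ ?_ ?_ ?_
  · intro i hi j hj h0
    have e := sub_eq_zero.1 h0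
    obtain ⟨t, ht, htq⟩ := qT j hj
    rcases pR i hi with hs | ⟨s, hs, hsp⟩
    · exact hna ⟨p i, hs, t, ht, by rw [e, htq]; abel⟩
    · refine hnb ⟨t, ht, s, hs, ?_⟩
      rw [hsp, htq, hn, add_smul] at e
      have e2 : s + (b : ℤ) • u = t := by
        apply add_right_cancel (b := (a : ℤ) • u)
        rw [← e]; abel
      rw [← e2]; abel
  · intro i hi
    rw [ell_sub, q0, ell_add_smul]
    linarith [(bR _ (pR i hi)).1]
  · intro j hj
    rw [ell_sub, pN, ell_add_smul]
    linarith [(bT _ (qT j hj)).2]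
  · intro j hj
    rw [ell_sub, p0]
    linarith [(bT _ (qT j hj)).1]
  · intro i hi
    rw [ell_sub, qM, ell_add_smul]
    linarith [(bR _ (pR i hi)).2]
  · rw [p0, q0, neg_smul]; abel
  · rw [pN, qM, hn, add_smul]; abel
end

section
/- (Discrete parallelogram chord lemma) Let G be a finite connected subgraph of the infinite grid graph on ℤ², and let u, v be non-parallel integer vectors. If G realises both u − v and u + v, then G realises u or G realises v. -/
/-- `u` and `v` are non-parallel (linearly independent over `ℚ`), i.e. have nonzero
determinant. -/
def nonParallel (u v : ℤ × ℤ) : Prop := u.1 * v.2 - u.2 * v.1 ≠ 0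

/-- The step relation of the grid graph inside a vertex set. -/
def stepIn (S : Finset (ℤ × ℤ)) (x y : ℤ × ℤ) : Prop := x ∈ S ∧ y ∈ S ∧ gridAdj x y

theorem gridAdj_cases {a b : ℤ × ℤ} (h : gridAdj a b) :
    (b.1 = a.1 + 1 ∧ b.2 = a.2) ∨ (a.1 = b.1 + 1 ∧ b.2 = a.2) ∨
    (b.1 = a.1 ∧ b.2 = a.2 + 1) ∨ (b.1 = a.1 ∧ a.2 = b.2 + 1) := by
  unfold gridAdj at h
  rcases abs_cases (a.1 - b.1) with h1 | h1 <;> rcases abs_cases (a.2 - b.2) with h2 | h2 <;> omega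

/-- Signed count of the vertical edges of a path from `q0` to `q` to the right of a point. -/
theorem exists_count (Q : Finset (ℤ × ℤ)) (q0 q : ℤ × ℤ)
    (h : Relation.ReflTransGen (stepIn Q) q0 q) :
    ∃ n : ℤ → ℤ → ℤ,
      (∀ x y, (x + 1, y) ∉ Q → n x y = n (x + 1) y) ∧
      (∀ x y, (x, y + 1) ∉ Q → n x y - n x (y + 1) =
        (if q.2 = y + 1 ∧ x < q.1 then 1 else 0) - (if q0.2 = y + 1 ∧ x < q0.1 then 1 else 0)) ∧
      (∀ x y, (∀ r ∈ Q, r.1 ≤ x) → n x y = 0) ∧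
      (∀ x y, (∀ r ∈ Q, x < r.1) → n x y =
        (if y < q.2 then 1 else 0) - (if y < q0.2 then 1 else 0)) := by
  induction h with
  | refl => exact ⟨fun _ _ => 0, by simp, by simp, by simp, by simp⟩
  | @tail b c _ hbc ih =>
    obtain ⟨n, hH, hV, hR, hL⟩ := ih
    obtain ⟨hb, hc, hadj⟩ := hbc
    obtain ⟨b1, b2⟩ := b
    obtain ⟨c1, c2⟩ := c
    have hne : ∀ x y, (x, y) ∉ Q → ¬ (x = b1 ∧ y = b2) ∧ ¬ (x = c1 ∧ y = c2) := by
      intro x y hxy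
      constructor
      · rintro ⟨rfl, rfl⟩; exact hxy hb
      · rintro ⟨rfl, rfl⟩; exact hxy hc
    refine ⟨fun x y => n x y + (if c2 = b2 + 1 ∧ y = b2 ∧ x < b1 then 1 else 0)
      - (if b2 = c2 + 1 ∧ y = c2 ∧ x < b1 then 1 else 0), ?_, ?_, ?_, ?_⟩
    · intro x y hxy
      have h1 := hH x y hxy
      have h2 := hne _ _ hxy
      have h3 := gridAdj_cases hadj
      simp only at h1 h2 h3 ⊢
      split_ifs <;> omega
    · intro x y hxy
      have h1 := hV x y hxy
      have h2 := hne _ _ hxy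
      have h3 := gridAdj_cases hadj
      simp only at h1 h2 h3 ⊢
      split_ifs at h1 ⊢ <;> omega
    · intro x y hxy
      have h1 := hR x y hxy
      have h2 := hxy _ hb
      simp only at h1 h2 ⊢
      split_ifs <;> omega
    · intro x y hxy
      have h1 := hL x y hxy
      have h2 := hxy _ hb
      have h3 := gridAdj_cases hadj
      simp only at h1 h2 h3 ⊢
      split_ifs at h1 ⊢ <;> omega

theorem ray_aux {α β γ δ s t : ℤ} (hα : 0 < α) (hδ : 0 < δ) (hD : 0 < α * δ - β * γ)
    (hs : 0 ≤ s) (ht : 0 < t) (h1 : α * s ≤ β * t) (h2 : δ * t ≤ γ * s) : False := by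
  have h3 : 0 < γ * s := lt_of_lt_of_le (mul_pos hδ ht) h2
  have hspos : 0 < s := by
    rcases hs.lt_or_eq with h | h
    · exact h
    · rw [← h] at h3; simp at h3
  have h4 : (α * s) * (δ * t) ≤ (β * t) * (γ * s) :=
    mul_le_mul h1 h2 (mul_pos hδ ht).le ((mul_pos hα hspos).le.trans h1)
  have h5 := mul_pos (mul_pos hspos ht) hD
  nlinarith

/-- Crossing lemma, normalised coefficients. -/
theorem crossing_norm (P Q : Finset (ℤ × ℤ)) (α β γ δ : ℤ) (hα : 0 < α) (hδ : 0 < δ)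
    (hD : 0 < α * δ - β * γ) (p0 p1 q0 q1 : ℤ × ℤ)
    (hp0 : p0 ∈ P) (hp1 : p1 ∈ P) (hq0 : q0 ∈ Q) (hq1 : q1 ∈ Q)
    (hP : Relation.ReflTransGen (stepIn P) p0 p1)
    (hQ : Relation.ReflTransGen (stepIn Q) q0 q1)
    (hf0 : ∀ r ∈ Q, α * p0.1 + β * p0.2 ≤ α * r.1 + β * r.2)
    (hf1 : ∀ r ∈ Q, α * r.1 + β * r.2 ≤ α * p1.1 + β * p1.2)
    (hg0 : ∀ r ∈ P, γ * q0.1 + δ * q0.2 ≤ γ * r.1 + δ * r.2)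
    (hg1 : ∀ r ∈ P, γ * r.1 + δ * r.2 ≤ γ * q1.1 + δ * q1.2) :
    ∃ r, r ∈ P ∧ r ∈ Q := by
  by_contra hdis
  push Not at hdis
  obtain ⟨n, hH, hV, hR, hL⟩ := exists_count Q q0 q1 hQ
  obtain ⟨a1, a2⟩ := q0
  obtain ⟨b1, b2⟩ := q1
  simp only at hV hL hg0 hg1
  set N : ℤ → ℤ → ℤ := fun x y => n x y + (if x < a1 ∧ y < a2 then 1 else 0)
    + (if x < b1 ∧ b2 ≤ y then 1 else 0) with hN
  have hNH : ∀ x y, (x + 1, y) ∉ Q → ¬ (x + 1 = a1 ∧ y < a2) → ¬ (x + 1 = b1 ∧ b2 < y) →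
      N x y = N (x + 1) y := by
    intro x y h1 h2 h3
    have h4 := hH x y h1
    have h5 : ¬ (x + 1 = b1 ∧ y = b2) := by rintro ⟨rfl, rfl⟩; exact h1 hq1
    simp only [hN]
    split_ifs <;> omega
  have hNV : ∀ x y, (x, y + 1) ∉ Q → N x y = N x (y + 1) := by
    intro x y h1
    have h4 := hV x y h1
    simp only [hN]
    split_ifs at h4 ⊢ <;> omega
  have hPray : ∀ r ∈ P, ¬ (r.1 = a1 ∧ r.2 < a2) ∧ ¬ (r.1 = b1 ∧ b2 < r.2) := by
    intro r hr
    have h0 := hg0 r hr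
    have h1 := hg1 r hr
    constructor
    · rintro ⟨e, h⟩; rw [e] at h0; nlinarith
    · rintro ⟨e, h⟩; rw [e] at h1; nlinarith
  have hstep : ∀ x y, stepIn P x y → N x.1 x.2 = N y.1 y.2 := by
    rintro ⟨x1, x2⟩ ⟨y1, y2⟩ ⟨hx, hy, hadj⟩
    have hxQ := hdis _ hx
    have hyQ := hdis _ hy
    have hxr := hPray _ hx
    have hyr := hPray _ hy
    rcases gridAdj_cases hadj with ⟨e1, e2⟩ | ⟨e1, e2⟩ | ⟨e1, e2⟩ | ⟨e1, e2⟩ <;>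
      simp only at e1 e2 hxr hyr ⊢ <;> subst e1 <;> subst e2
    · exact hNH _ _ hyQ hyr.1 hyr.2
    · exact (hNH _ _ hxQ hxr.1 hxr.2).symm
    · exact hNV _ _ hyQ
    · exact (hNV _ _ hxQ).symm
  have hpath : N p0.1 p0.2 = N p1.1 p1.2 := by
    clear hf1 hp1
    induction hP with
    | refl => rfl
    | tail _ h ih => exact ih.trans (hstep _ _ h)
  have hp0Q := hdis _ hp0
  have hp1Q := hdis _ hp1
  obtain ⟨c1, c2⟩ := p0
  obtain ⟨d1, d2⟩ := p1
  simp only at hf0 hf1 hpath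
  -- left ray
  have hleftQ : ∀ s : ℤ, 0 ≤ s → (c1 - s, c2) ∉ Q := by
    intro s hs hmem
    rcases hs.lt_or_eq with h | h
    · have := hf0 _ hmem
      simp only at this
      nlinarith
    · rw [← h] at hmem; simp at hmem; exact hp0Q hmem
  have hleft : ∀ s : ℕ, N (c1 - s) c2 = N c1 c2 := by
    intro s
    induction s with
    | zero => simp
    | succ k ih =>
      rw [← ih]
      have hk : (0 : ℤ) ≤ k := by positivity
      have e : c1 - ((k + 1 : ℕ) : ℤ) + 1 = c1 - k := by push_cast; ring
      have := hNH (c1 - ((k + 1 : ℕ) : ℤ)) c2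
      rw [e] at this
      refine this (hleftQ _ hk) ?_ ?_
      · rintro ⟨e1, h⟩
        have h1 := hf0 _ hq0
        have h2 := hg0 _ hp0
        simp only at h1 h2
        refine ray_aux (s := k) (t := a2 - c2) hα hδ hD hk (by omega) ?_ ?_
        · rw [← e1] at h1; linarith
        · rw [← e1] at h2; linarith
      · rintro ⟨e1, h⟩
        have h1 := hf0 _ hq1
        have h2 := hg1 _ hp0
        simp only at h1 h2
        refine ray_aux (β := -β) (γ := -γ) (s := k) (t := c2 - b2) hα hδ (by linarith) hk
          (by omega) ?_ ?_
        · rw [← e1] at h1; linarith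
        · rw [← e1] at h2; linarith
  have hrightQ : ∀ s : ℤ, 0 ≤ s → (d1 + s, d2) ∉ Q := by
    intro s hs hmem
    rcases hs.lt_or_eq with h | h
    · have := hf1 _ hmem
      simp only at this
      nlinarith
    · rw [← h] at hmem; simp at hmem; exact hp1Q hmem
  have hright : ∀ s : ℕ, N (d1 + s) d2 = N d1 d2 := by
    intro s
    induction s with
    | zero => simp
    | succ k ih =>
      rw [← ih]
      have hk : (0 : ℤ) ≤ ((k + 1 : ℕ) : ℤ) := by positivity
      have e : d1 + (k : ℤ) + 1 = d1 + ((k + 1 : ℕ) : ℤ) := by push_cast; ring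
      have := hNH (d1 + k) d2
      rw [e] at this
      refine (this (hrightQ _ hk) ?_ ?_).symm
      · rintro ⟨e1, h⟩
        have h1 := hf1 _ hq0
        have h2 := hg0 _ hp1
        simp only at h1 h2
        refine ray_aux (β := -β) (γ := -γ) (s := ((k + 1 : ℕ) : ℤ)) (t := a2 - d2) hα hδ
          (by linarith) hk (by omega) ?_ ?_
        · rw [← e1] at h1; linarith
        · rw [← e1] at h2; linarith
      · rintro ⟨e1, h⟩
        have h1 := hf1 _ hq1
        have h2 := hg1 _ hp1
        simp only at h1 h2
        refine ray_aux (s := ((k + 1 : ℕ) : ℤ)) (t := d2 - b2) hα hδ hD hk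
          (by omega) ?_ ?_
        · rw [← e1] at h1; linarith
        · rw [← e1] at h2; linarith
  -- bounds for `Q`
  obtain ⟨lo, -, hlo⟩ := Q.exists_min_image (fun r => r.1) ⟨_, hq0⟩
  obtain ⟨hi, -, hhi⟩ := Q.exists_max_image (fun r => r.1) ⟨_, hq0⟩
  have hl := hleft (c1 - lo.1 + 1).toNat
  have hr := hright (hi.1 - d1).toNat
  have hl0 := Int.self_le_toNat (c1 - lo.1 + 1)
  have hr0 := Int.self_le_toNat (hi.1 - d1)
  generalize (((c1 - lo.1 + 1).toNat : ℕ) : ℤ) = s at hl hl0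
  generalize (((hi.1 - d1).toNat : ℕ) : ℤ) = t at hr hr0
  have hl1 := hL (c1 - s) c2 (fun r hr => by have := hlo r hr; omega)
  have hr1 := hR (d1 + t) d2 (fun r hr => by have := hhi r hr; omega)
  have l1 := hlo _ hq0
  have l2 := hlo _ hq1
  have r1 := hhi _ hq0
  have r2 := hhi _ hq1
  simp only at l1 l2 r1 r2
  have e1 : N (c1 - s) c2 = 1 := by
    simp only [hN]
    rw [hl1]
    split_ifs <;> omega
  have e2 : N (d1 + t) d2 = 0 := by
    simp only [hN]
    rw [hr1]
    split_ifs <;> omega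
  omega

theorem stepIn_symm (S : Finset (ℤ × ℤ)) {x y : ℤ × ℤ}
    (h : Relation.ReflTransGen (stepIn S) x y) : Relation.ReflTransGen (stepIn S) y x := by
  induction h with
  | refl => exact Relation.ReflTransGen.refl
  | @tail a b _ hs ih =>
  obtain ⟨ha, hb, hab⟩ := hs
  refine Relation.ReflTransGen.head ⟨hb, ha, ?_⟩ ih
  unfold gridAdj at *
  rw [abs_sub_comm b.1, abs_sub_comm b.2]
  exact hab

/-- Crossing lemma. -/
theorem crossing_s6 (P Q : Finset (ℤ × ℤ)) (α β γ δ : ℤ)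
    (hD : 0 < α * δ - β * γ) (p0 p1 q0 q1 : ℤ × ℤ)
    (hp0 : p0 ∈ P) (hp1 : p1 ∈ P) (hq0 : q0 ∈ Q) (hq1 : q1 ∈ Q)
    (hP : Relation.ReflTransGen (stepIn P) p0 p1)
    (hQ : Relation.ReflTransGen (stepIn Q) q0 q1)
    (hf0 : ∀ r ∈ Q, α * p0.1 + β * p0.2 ≤ α * r.1 + β * r.2)
    (hf1 : ∀ r ∈ Q, α * r.1 + β * r.2 ≤ α * p1.1 + β * p1.2)
    (hg0 : ∀ r ∈ P, γ * q0.1 + δ * q0.2 ≤ γ * r.1 + δ * r.2)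
    (hg1 : ∀ r ∈ P, γ * r.1 + δ * r.2 ≤ γ * q1.1 + δ * q1.2) :
    ∃ r, r ∈ P ∧ r ∈ Q := by
  by_cases h1 : 0 < α * δ
  · rcases pos_and_pos_or_neg_and_neg_of_mul_pos h1 with ⟨ha, hd⟩ | ⟨ha, hd⟩
    · exact crossing_norm P Q α β γ δ ha hd hD p0 p1 q0 q1 hp0 hp1 hq0 hq1 hP hQ hf0 hf1 hg0 hg1
    · exact crossing_norm P Q (-α) (-β) (-γ) (-δ) (by omega) (by omega) (by linarith)
        p1 p0 q1 q0 hp1 hp0 hq1 hq0 (stepIn_symm _ hP) (stepIn_symm _ hQ)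
        (fun r hr => by linarith [hf1 r hr]) (fun r hr => by linarith [hf0 r hr])
        (fun r hr => by linarith [hg1 r hr]) (fun r hr => by linarith [hg0 r hr])
  · have h2 : β * γ < 0 := by linarith
    rcases mul_neg_iff.1 h2 with ⟨hb, hc⟩ | ⟨hb, hc⟩
    · obtain ⟨r, h, hmem2⟩ := crossing_norm Q P (-γ) (-δ) α β (by omega) (by omega) (by linarith)
        q1 q0 p0 p1 hq1 hq0 hp0 hp1 (stepIn_symm _ hQ) hP
        (fun r hr => by linarith [hg1 r hr]) (fun r hr => by linarith [hg0 r hr])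
        (fun r hr => by linarith [hf0 r hr]) (fun r hr => by linarith [hf1 r hr])
      exact ⟨r, hmem2, h⟩
    · obtain ⟨r, h, hmem2⟩ := crossing_norm Q P γ δ (-α) (-β) (by omega) (by omega) (by linarith)
        q0 q1 p1 p0 hq0 hq1 hp1 hp0 hQ (stepIn_symm _ hP)
        (fun r hr => by linarith [hg0 r hr]) (fun r hr => by linarith [hg1 r hr])
        (fun r hr => by linarith [hf1 r hr]) (fun r hr => by linarith [hf0 r hr])
      exact ⟨r, hmem2, h⟩

/-- The union of two translates of `S`. -/
def twoTranslates (S : Finset (ℤ × ℤ)) (a b : ℤ × ℤ) : Finset (ℤ × ℤ) :=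
  S.image (· + a) ∪ S.image (· + b)

theorem mem_twoTranslates (S : Finset (ℤ × ℤ)) (a b r : ℤ × ℤ) :
    r ∈ twoTranslates S a b ↔ (∃ x ∈ S, r = x + a) ∨ (∃ x ∈ S, r = x + b) := by
  simp only [twoTranslates, Finset.mem_union, Finset.mem_image, eq_comm]

theorem twoTranslates_path (S : Finset (ℤ × ℤ)) (hconn : connectedIn S) (a b : ℤ × ℤ)
    {s t x y : ℤ × ℤ} (hs : s ∈ S) (ht : t ∈ S) (hst : s + a = t + b) (hx : x ∈ S) (hy : y ∈ S) :
    Relation.ReflTransGen (stepIn (twoTranslates S a b)) (x + a) (y + b) := by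
  have key : ∀ c, (c = a ∨ c = b) → ∀ z ∈ S, ∀ w ∈ S,
      Relation.ReflTransGen (stepIn (twoTranslates S a b)) (z + c) (w + c) := by
    intro c hc z hz w hw
    refine Relation.ReflTransGen.lift (· + c) ?_ _ _ (hconn z hz w hw)
    rintro i j ⟨hi, hj, hij⟩
    refine ⟨(mem_twoTranslates ..).2 ?_, (mem_twoTranslates ..).2 ?_, ?_⟩
    · rcases hc with rfl | rfl
      · exact Or.inl ⟨i, hi, rfl⟩
      · exact Or.inr ⟨i, hi, rfl⟩
    · rcases hc with rfl | rfl
      · exact Or.inl ⟨j, hj, rfl⟩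
      · exact Or.inr ⟨j, hj, rfl⟩
    · unfold gridAdj at *
      simpa using hij
  have h1 := key a (Or.inl rfl) x hx s hs
  have h2 := key b (Or.inr rfl) t ht y hy
  rw [hst] at h1
  exact h1.trans h2

theorem chord_pos (S : Finset (ℤ × ℤ)) (hconn : connectedIn S)
    (u v : ℤ × ℤ) (huv : 0 < u.1 * v.2 - u.2 * v.1)
    (h₁ : realises S (u - v)) (h₂ : realises S (u + v)) :
    realises S u ∨ realises S v := by
  obtain ⟨a, ha, b, hb, hab⟩ := h₁
  obtain ⟨c, hc, d, hd, hcd⟩ := h₂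
  obtain ⟨p0, hp0, hf0⟩ := S.exists_min_image (fun r => v.2 * r.1 + (-v.1) * r.2) ⟨a, ha⟩
  obtain ⟨p1, hp1, hf1⟩ := S.exists_max_image (fun r => v.2 * r.1 + (-v.1) * r.2) ⟨a, ha⟩
  obtain ⟨q0, hq0, hg0⟩ := S.exists_min_image (fun r => (-u.2) * r.1 + u.1 * r.2) ⟨a, ha⟩
  obtain ⟨q1, hq1, hg1⟩ := S.exists_max_image (fun r => (-u.2) * r.1 + u.1 * r.2) ⟨a, ha⟩
  have e1 : c + 0 = d + (u + v) := by rw [← hcd]; abel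
  have e2 : b + u = a + v := by
    have : a = u - v + b := sub_eq_iff_eq_add.1 hab
    rw [this]; abel
  obtain ⟨r, hrP, hrQ⟩ := crossing_s6 (twoTranslates S 0 (u + v)) (twoTranslates S u v)
    v.2 (-v.1) (-u.2) u.1 (by linarith) (p0 + 0) (p1 + (u + v)) (q0 + u) (q1 + v)
    ((mem_twoTranslates ..).2 (Or.inl ⟨_, hp0, rfl⟩))
    ((mem_twoTranslates ..).2 (Or.inr ⟨_, hp1, rfl⟩))
    ((mem_twoTranslates ..).2 (Or.inl ⟨_, hq0, rfl⟩))
    ((mem_twoTranslates ..).2 (Or.inr ⟨_, hq1, rfl⟩))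
    (twoTranslates_path S hconn _ _ hc hd e1 hp0 hp1)
    (twoTranslates_path S hconn _ _ hb ha e2 hq0 hq1)
    (by
      intro r hr
      rcases (mem_twoTranslates ..).1 hr with ⟨x, hx, rfl⟩ | ⟨x, hx, rfl⟩ <;>
      · have := hf0 x hx
        simp only [Prod.fst_add, Prod.snd_add, Prod.fst_zero, Prod.snd_zero] at this ⊢
        linarith)
    (by
      intro r hr
      rcases (mem_twoTranslates ..).1 hr with ⟨x, hx, rfl⟩ | ⟨x, hx, rfl⟩ <;>
      · have := hf1 x hx
        simp only [Prod.fst_add, Prod.snd_add, Prod.fst_zero, Prod.snd_zero] at this ⊢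
        linarith)
    (by
      intro r hr
      rcases (mem_twoTranslates ..).1 hr with ⟨x, hx, rfl⟩ | ⟨x, hx, rfl⟩ <;>
      · have := hg0 x hx
        simp only [Prod.fst_add, Prod.snd_add, Prod.fst_zero, Prod.snd_zero] at this ⊢
        linarith)
    (by
      intro r hr
      rcases (mem_twoTranslates ..).1 hr with ⟨x, hx, rfl⟩ | ⟨x, hx, rfl⟩ <;>
      · have := hg1 x hx
        simp only [Prod.fst_add, Prod.snd_add, Prod.fst_zero, Prod.snd_zero] at this ⊢
        linarith)
  rcases (mem_twoTranslates ..).1 hrP with ⟨x, hx, rfl⟩ | ⟨x, hx, rfl⟩ <;>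
    rcases (mem_twoTranslates ..).1 hrQ with ⟨y, hy, e⟩ | ⟨y, hy, e⟩
  · left; exact ⟨x, hx, y, hy, by rw [sub_eq_iff_eq_add, add_comm u, ← e, add_zero]⟩
  · right; exact ⟨x, hx, y, hy, by rw [sub_eq_iff_eq_add, add_comm v, ← e, add_zero]⟩
  · right; exact ⟨y, hy, x, hx, by
      rw [sub_eq_iff_eq_add]; apply add_right_cancel (b := u); rw [← e]; abel⟩
  · left; exact ⟨y, hy, x, hx, by
      rw [sub_eq_iff_eq_add]; apply add_right_cancel (b := v); rw [← e]; abel⟩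

/-- Discrete parallelogram chord lemma: if a finite connected subgraph of the grid graph
realises both `u - v` and `u + v` with `u, v` non-parallel, then it realises `u` or `v`. -/
theorem discrete_parallelogram_chord (S : Finset (ℤ × ℤ)) (hconn : connectedIn S)
    (u v : ℤ × ℤ) (huv : nonParallel u v)
    (h₁ : realises S (u - v)) (h₂ : realises S (u + v)) :
    realises S u ∨ realises S v := by
  rcases lt_or_gt_of_ne huv with h | h
  · refine (chord_pos S hconn v u (by linarith) ?_ ?_).symm
    · obtain ⟨a, ha, b, hb, hab⟩ := h₁
      exact ⟨b, hb, a, ha, by rw [← neg_sub a b, hab, neg_sub]⟩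
    · rwa [add_comm]
  · exact chord_pos S hconn u v h h₁ h₂
end
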